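/- arXiv:2504.01497 — 2 statements merged into one kernel-verified Lean document; each statement's English description precedes it below -/
import Mathlib

section
/- Let (x_k), (v_k) be generated by the symplectic Euler scheme, and suppose conditions (1), (2), (3) on (s, Δ₁, Δ₂) hold with the strict inequality Δ₂√s < 1/L. Then for all k ≥ 0, f(x_k) − f(x*) ≤ (1/((1 − LΔ₂√s)(1+Δ₁)))·(1 + √(μs)/(1+√(μs)))^{−k}·E(0). -/
open scoped RealInnerProductSpace Gradient Topology

section GradientInequalities

variable {H : Type*} [NormedAddCommGroup H] [InnerProductSpace ℝ H] [CompleteSpace H] {f : H → ℝ}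

theorem Differentiable.hasDerivAt_add_smul_inner_gradient (hf : Differentiable ℝ f) (x d : H)
    (t : ℝ) : HasDerivAt (fun t : ℝ => f (x + t • d)) ⟪∇ f (x + t • d), d⟫ t := by
  have hline : HasDerivAt (fun t : ℝ => x + t • d) d t := by
    simpa using ((hasDerivAt_id t).smul_const d).const_add x
  rw [inner_gradient_left]
  exact (hf (x + t • d)).hasFDerivAt.comp_hasDerivAt t hline

/-- First-order lower bound for a differentiable strongly convex function. -/
theorem StrongConvexOn.add_inner_gradient_add_le {μ : ℝ} (hsc : StrongConvexOn Set.univ μ f)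
    (hf : Differentiable ℝ f) (x y : H) :
    f x + ⟪∇ f x, y - x⟫ + μ / 2 * ‖y - x‖ ^ 2 ≤ f y := by
  have hslope : Filter.Tendsto (fun t : ℝ => t⁻¹ * (f (x + t • (y - x)) - f x)) (𝓝[>] 0)
      (𝓝 ⟪∇ f x, y - x⟫) := by
    simpa using (hf.hasDerivAt_add_smul_inner_gradient x (y - x) 0).tendsto_slope_zero_right
  have hbound : Filter.Tendsto
      (fun t : ℝ => f y - f x - (1 - t) * (μ / 2 * ‖y - x‖ ^ 2)) (𝓝[>] 0)
      (𝓝 (f y - f x - (1 - 0) * (μ / 2 * ‖y - x‖ ^ 2))) := by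
    refine Filter.Tendsto.mono_left (Continuous.tendsto ?_ 0) nhdsWithin_le_nhds
    fun_prop
  have hle := le_of_tendsto_of_tendsto hslope hbound (by
    filter_upwards [Ioo_mem_nhdsGT (zero_lt_one' ℝ)] with t ht
    have hconv := hsc.2 (Set.mem_univ x) (Set.mem_univ y) (sub_nonneg.2 ht.2.le) ht.1.le
      (sub_add_cancel 1 t)
    have hpoint : (1 - t) • x + t • y = x + t • (y - x) := by module
    rw [hpoint, norm_sub_rev x y] at hconv
    simp only [smul_eq_mul] at hconv
    rw [inv_mul_le_iff₀ ht.1]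
    linarith)
  linarith

/-- The descent lemma. -/
theorem le_add_inner_gradient_add_of_lipschitz {L : ℝ} (hf : Differentiable ℝ f)
    (hL : ∀ x y, ‖∇ f x - ∇ f y‖ ≤ L * ‖x - y‖) (x y : H) :
    f y ≤ f x + ⟪∇ f x, y - x⟫ + L / 2 * ‖y - x‖ ^ 2 := by
  set d := y - x with hd
  have hline := hf.hasDerivAt_add_smul_inner_gradient x d
  have hquad (t : ℝ) : HasDerivAt
      (fun t : ℝ => f x + t * ⟪∇ f x, d⟫ + L / 2 * ‖d‖ ^ 2 * t ^ 2)
      (⟪∇ f x, d⟫ + L * ‖d‖ ^ 2 * t) t := by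
    refine ((((hasDerivAt_id t).mul_const ⟪∇ f x, d⟫).const_add (f x)).add
      ((hasDerivAt_pow 2 t).const_mul (L / 2 * ‖d‖ ^ 2))).congr_deriv ?_
    push_cast
    ring
  have key := image_le_of_deriv_right_le_deriv_boundary (a := 0) (b := 1)
    (fun t _ => (hline t).continuousAt.continuousWithinAt)
    (fun t _ => (hline t).hasDerivWithinAt) (by simp)
    (fun t _ => (hquad t).continuousAt.continuousWithinAt)
    (fun t _ => (hquad t).hasDerivWithinAt) (fun t ht => by
      have hinner := real_inner_le_norm (∇ f (x + t • d) - ∇ f x) d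
      have hlip := hL (x + t • d) x
      rw [add_sub_cancel_left, norm_smul, Real.norm_of_nonneg ht.1] at hlip
      rw [inner_sub_left] at hinner
      nlinarith [mul_le_mul_of_nonneg_right hlip (norm_nonneg d)])
    (Set.right_mem_Icc.2 zero_le_one)
  simpa [hd] using key

/-- Smoothness improves the gradient inequality by the squared distance of the gradients. -/
theorem add_inner_gradient_add_norm_sq_gradient_sub_le {L : ℝ} (hL₀ : 0 < L)
    (hf : Differentiable ℝ f) (hconv : ∀ x y, f x + ⟪∇ f x, y - x⟫ ≤ f y)
    (hL : ∀ x y, ‖∇ f x - ∇ f y‖ ≤ L * ‖x - y‖) (x y : H) :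
    f x + ⟪∇ f x, y - x⟫ + 1 / (2 * L) * ‖∇ f y - ∇ f x‖ ^ 2 ≤ f y := by
  set d := ∇ f y - ∇ f x with hd
  have hlower := hconv x (y - L⁻¹ • d)
  have hupper := le_add_inner_gradient_add_of_lipschitz hf hL y (y - L⁻¹ • d)
  have hsplit : y - L⁻¹ • d - x = (y - x) - L⁻¹ • d := by abel
  have hstep : y - L⁻¹ • d - y = -(L⁻¹ • d) := by abel
  have hdd : ⟪∇ f y, d⟫ - ⟪∇ f x, d⟫ = ‖d‖ ^ 2 := by
    rw [← inner_sub_left, ← hd, real_inner_self_eq_norm_sq]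
  rw [hsplit, inner_sub_right, inner_smul_right] at hlower
  rw [hstep, inner_neg_right, inner_smul_right, norm_neg, norm_smul, Real.norm_of_nonneg
    (inv_nonneg.2 hL₀.le), mul_pow] at hupper
  have hcoef : 1 / (2 * L) * ‖d‖ ^ 2
      = L⁻¹ * (⟪∇ f y, d⟫ - ⟪∇ f x, d⟫) - L / 2 * (L⁻¹ ^ 2 * ‖d‖ ^ 2) := by
    rw [hdd]
    field_simp
    ring
  linarith

end GradientInequalities

/-- The change of the energy over one step of the symplectic Euler scheme, with `w = v (k + 1)`,
`y = x (k + 1) - xs` and `g`, `g'` the gradients at `x k` and `x (k + 1)`. -/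
theorem symplectic_euler_energy_identity {H : Type*} [NormedAddCommGroup H]
    [InnerProductSpace ℝ H] (w y g g' : H) {m h a D θ : ℝ} (hθ : θ * (1 + m * h) = m * h) :
    (1 + θ) * (1 / 2 * ‖(1 + m * h) • w + m • y + D • g'‖ ^ 2)
      - 1 / 2 * ‖((1 + 2 * m * h) • w + (h * a) • g' + D • (g' - g)) + m • y + D • g‖ ^ 2
      + a * h * ⟪g', (1 + 2 * m * h) • w + (h * a) • g' + D • (g' - g)⟫
      - a * (D * h / 2) * ((1 + θ) * ‖g'‖ ^ 2 - ‖g‖ ^ 2)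
    = -(m * h * (1 + m * h) / 2 + (m * h) ^ 2 / 2) * ‖w‖ ^ 2
      + (θ * m * D - h * a * m) * ⟪g', y⟫ + θ * m ^ 2 / 2 * ‖y‖ ^ 2
      + 1 / 2 * (θ * D ^ 2 - D * h * a * (θ + 2) + a ^ 2 * h ^ 2) * ‖g'‖ ^ 2
      + a * h * D / 2 * ‖g' - g‖ ^ 2 := by
  simp only [← real_inner_self_eq_norm_sq, inner_add_left, inner_add_right, inner_sub_left,
    inner_sub_right, real_inner_smul_left, real_inner_smul_right]
  rw [real_inner_comm w g', real_inner_comm w y, real_inner_comm w g, real_inner_comm g' y,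
    real_inner_comm g' g, real_inner_comm y g]
  linear_combination ((1 + m * h) / 2 * ⟪w, w⟫ + m * ⟪w, y⟫ + D * ⟪w, g'⟫) * hθ

/-- for the symplectic Euler scheme under conditions (1)–(3), with the strict
inequality `Δ₂√s < 1/L`, the function values converge at the stated rate. -/
theorem symplectic_euler_function_value_rate
    {H : Type*} [NormedAddCommGroup H] [InnerProductSpace ℝ H] [CompleteSpace H]
    (f : H → ℝ) (μ L : ℝ) (hμ : 0 < μ)
    (hf : ContDiff ℝ 1 f) (hsc : StrongConvexOn Set.univ μ f)
    (hL : ∀ x y, ‖gradient f x - gradient f y‖ ≤ L * ‖x - y‖)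
    (xs : H) (hmin : ∀ y, f xs ≤ f y)
    (s : ℝ) (hs : 0 < s)
    (Δ₁ Δ₂ : ℝ) (hΔ₁ : 0 ≤ Δ₁) (hΔ₂ : 0 ≤ Δ₂)
    (x v : ℕ → H)
    (hx : ∀ k, (Real.sqrt s)⁻¹ • (x (k + 1) - x k) = v k)
    (hv : ∀ k, (Real.sqrt s)⁻¹ • (v (k + 1) - v k) =
      -((2 * Real.sqrt μ) • v (k + 1)) - (1 + Δ₁) • gradient f (x (k + 1))
        - (Δ₂ / Real.sqrt s) • (gradient f (x (k + 1)) - gradient f (x k)))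
    (E : ℕ → ℝ)
    (hE : ∀ k, E k = (1 + Real.sqrt (μ * s) / (1 + Real.sqrt (μ * s))) ^ k *
      ((1 + Δ₁) * (f (x k) - f xs - Δ₂ * Real.sqrt s / 2 * ‖gradient f (x k)‖ ^ 2) +
        (1 / 2) * ‖v k + Real.sqrt μ • (x (k + 1) - xs) + Δ₂ • gradient f (x k)‖ ^ 2))
    (h1 : Δ₂ * Real.sqrt s < 1 / L)
    (h2 : Δ₂ ≤ Real.sqrt s * (1 + Δ₁))
    (h3 : Real.sqrt (μ * s) / (1 + Real.sqrt (μ * s)) * Δ₂ ^ 2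
      - Δ₂ * Real.sqrt s * (1 + Δ₁) * (Real.sqrt (μ * s) / (1 + Real.sqrt (μ * s)) + 2)
      + (1 + Δ₁) ^ 2 * s
      - Real.sqrt (μ * s) / (1 + Real.sqrt (μ * s)) * (Δ₁ / L)
      + 2 * μ * Real.sqrt s / ((1 + Real.sqrt (μ * s)) * L)
          * (Δ₂ - Real.sqrt s * (1 + Δ₁)) ≤ 0) :
    ∀ k, f (x k) - f xs ≤
      1 / ((1 - L * Δ₂ * Real.sqrt s) * (1 + Δ₁)) *
        ((1 + Real.sqrt (μ * s) / (1 + Real.sqrt (μ * s))) ^ k)⁻¹ * E 0 := by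
  have hdiff : Differentiable ℝ f := hf.differentiable one_ne_zero
  have hL₀ : 0 < L := one_div_pos.1 (lt_of_le_of_lt (by positivity) h1)
  have hsqrt : √(μ * s) = √μ * √s := Real.sqrt_mul hμ.le s
  rw [hsqrt] at h3
  simp only [hsqrt] at hE ⊢
  have hm₀ : 0 < √μ := Real.sqrt_pos.2 hμ
  have hh₀ : 0 < √s := Real.sqrt_pos.2 hs
  have hm : √μ ^ 2 = μ := Real.sq_sqrt hμ.le
  have hh : √s ^ 2 = s := Real.sq_sqrt hs.le
  set m := √μ
  set h := √s
  set θ := m * h / (1 + m * h) with hθ_def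
  have hq : 0 < 1 + m * h := by positivity
  have hθ₀ : 0 < θ := by positivity
  have hθ : θ * (1 + m * h) = m * h := div_mul_cancel₀ _ hq.ne'
  have hD : L * Δ₂ * h < 1 := by
    rw [lt_div_iff₀ hL₀] at h1
    linarith
  have hstrong (x y : H) := hsc.add_inner_gradient_add_le hdiff x y
  have hcoc := add_inner_gradient_add_norm_sq_gradient_sub_le hL₀ hdiff
    (fun x y => by nlinarith [hstrong x y, mul_nonneg hμ.le (sq_nonneg ‖y - x‖)]) hL
  have hgrad : ∇ f xs = 0 := by
    rw [gradient, IsLocalMin.fderiv_eq_zero (Filter.Eventually.of_forall hmin), map_zero]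
  have hgap (z : H) : 1 / (2 * L) * ‖∇ f z‖ ^ 2 ≤ f z - f xs := by
    have := hcoc xs z
    simp only [hgrad, inner_zero_left, sub_zero] at this
    linarith
  have hgap' (z : H) : f z - f xs ≤ ⟪∇ f z, z - xs⟫ - 1 / (2 * L) * ‖∇ f z‖ ^ 2 := by
    have := hcoc z xs
    rw [hgrad, zero_sub, norm_neg, ← neg_sub z xs, inner_neg_right] at this
    linarith
  have hgap_strong (z : H) : f z - f xs ≤ ⟪∇ f z, z - xs⟫ - μ / 2 * ‖z - xs‖ ^ 2 := by
    have := hstrong z xs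
    rw [← neg_sub z xs, norm_neg, inner_neg_right] at this
    linarith
  have hxstep (k : ℕ) : x (k + 1) = x k + h • v k := by
    rw [← hx k, smul_inv_smul₀ hh₀.ne', add_sub_cancel]
  have hvstep (k : ℕ) : v k = (1 + 2 * m * h) • v (k + 1) + (h * (1 + Δ₁)) • ∇ f (x (k + 1))
      + Δ₂ • (∇ f (x (k + 1)) - ∇ f (x k)) := by
    have hdiv : h * (Δ₂ / h) = Δ₂ := mul_div_cancel₀ _ hh₀.ne'
    have := congrArg (h • ·) (hv k)
    simp only [smul_inv_smul₀ hh₀.ne', smul_sub h, smul_smul, hdiv] at this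
    linear_combination (norm := module) -this
  have hdecr (k : ℕ) : E (k + 1) ≤ E k := by
    rw [hE, hE, pow_succ, mul_assoc]
    refine mul_le_mul_of_nonneg_left ?_ (by positivity)
    have hW' : v (k + 1) + m • (x (k + 1 + 1) - xs) + Δ₂ • ∇ f (x (k + 1))
        = (1 + m * h) • v (k + 1) + m • (x (k + 1) - xs) + Δ₂ • ∇ f (x (k + 1)) := by
      rw [hxstep (k + 1)]
      module
    have hid := symplectic_euler_energy_identity (v (k + 1)) (x (k + 1) - xs) (∇ f (x k))
      (∇ f (x (k + 1))) (a := 1 + Δ₁) (D := Δ₂) hθ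
    rw [← hvstep k, ← hW'] at hid
    have hback := hcoc (x (k + 1)) (x k)
    have hxback : x k - x (k + 1) = -(h • v k) := by
      rw [hxstep k]
      abel
    rw [hxback, inner_neg_right, inner_smul_right, norm_sub_rev] at hback
    have hF := hgap (x (k + 1))
    have hF₁ := hgap' (x (k + 1))
    have hF₂ := hgap_strong (x (k + 1))
    set P := ⟪∇ f (x (k + 1)), x (k + 1) - xs⟫
    set G := ‖∇ f (x (k + 1))‖ ^ 2
    set Y := ‖x (k + 1) - xs‖ ^ 2
    set Q := ‖∇ f (x (k + 1)) - ∇ f (x k)‖ ^ 2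
    have hP : 1 / L * G ≤ P := by
      have : 1 / L * G = 1 / (2 * L) * G + 1 / (2 * L) * G := by
        field_simp
        ring
      linarith
    have hcond : θ * Δ₂ ^ 2 - Δ₂ * h * (1 + Δ₁) * (θ + 2) + (1 + Δ₁) ^ 2 * h ^ 2
        ≤ θ * (Δ₁ / L + 2 * (1 / L) * (m * (h * (1 + Δ₁) - Δ₂))) := by
      have hcoef : 2 * μ * h / ((1 + m * h) * L) = θ * (2 * (1 / L) * m) := by
        rw [hθ_def, ← hm]
        field_simp
      rw [hcoef, ← hh] at h3
      linarith
    have hdescent := mul_le_mul_of_nonneg_left hback (add_nonneg zero_le_one hΔ₁)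
    have hQ : (1 + Δ₁) * (h * Δ₂ / 2 * Q) ≤ (1 + Δ₁) * (1 / (2 * L) * Q) := by
      have : h * Δ₂ / 2 ≤ 1 / (2 * L) := by
        rw [le_div_iff₀ (by positivity)]
        linarith
      gcongr
    have hV : 0 ≤ (m * h * (1 + m * h) / 2 + (m * h) ^ 2 / 2) * ‖v (k + 1)‖ ^ 2 := by positivity
    have hrest : θ * ((1 + Δ₁) * (f (x (k + 1)) - f xs) + μ / 2 * Y
        - (1 + Δ₁ + m * (h * (1 + Δ₁) - Δ₂)) * P
        + 1 / 2 * (Δ₁ / L + 2 * (1 / L) * (m * (h * (1 + Δ₁) - Δ₂))) * G) ≤ 0 := by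
      refine mul_nonpos_of_nonneg_of_nonpos hθ₀.le ?_
      have hcorr := mul_le_mul_of_nonneg_left hP (mul_nonneg hm₀.le (sub_nonneg.2 h2))
      have hcoc₁ := mul_le_mul_of_nonneg_left hF₁ hΔ₁
      have hhalf : Δ₁ * (1 / (2 * L) * G) = 1 / 2 * (Δ₁ / L) * G := by field_simp
      linarith
    have hcondG := mul_le_mul_of_nonneg_right hcond (sq_nonneg ‖∇ f (x (k + 1))‖)
    have hcross : (θ * m * Δ₂ - h * (1 + Δ₁) * m) * P
        = -(θ * (1 + Δ₁ + m * (h * (1 + Δ₁) - Δ₂)) * P) := by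
      linear_combination (1 + Δ₁) * P * hθ
    rw [hm, hcross] at hid
    linarith
  intro k
  have hEk : E k ≤ E 0 := antitone_nat_of_succ_le hdecr (Nat.zero_le k)
  rw [hE k] at hEk
  have hpow : 0 < (1 + θ) ^ k := by positivity
  have hfac : 0 < (1 - L * Δ₂ * h) * (1 + Δ₁) := mul_pos (sub_pos.2 hD) (by linarith)
  rw [one_div, ← mul_inv, ← div_eq_inv_mul, le_div_iff₀ (by positivity)]
  refine le_trans ?_ hEk
  have hlow : (1 - L * Δ₂ * h) * (f (x k) - f xs)
      ≤ f (x k) - f xs - Δ₂ * h / 2 * ‖∇ f (x k)‖ ^ 2 := by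
    have := mul_le_mul_of_nonneg_left (hgap (x k)) (by positivity : 0 ≤ L * Δ₂ * h)
    have hcoef : L * Δ₂ * h * (1 / (2 * L) * ‖∇ f (x k)‖ ^ 2)
        = Δ₂ * h / 2 * ‖∇ f (x k)‖ ^ 2 := by field_simp
    linarith
  calc (f (x k) - f xs) * ((1 - L * Δ₂ * h) * (1 + Δ₁) * (1 + θ) ^ k)
      = (1 + θ) ^ k * ((1 + Δ₁) * ((1 - L * Δ₂ * h) * (f (x k) - f xs))) := by ring
    _ ≤ _ := by
      gcongr
      refine le_trans (mul_le_mul_of_nonneg_left hlow (by positivity)) ?_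
      exact le_add_of_nonneg_right (by positivity)
end

section
/- Let (x_k), (v_k) be generated by the modified symplectic Euler scheme, and suppose the parameters satisfy (1) Δ₂√s/(1−√(μs)) ≤ 1/L with the strict inequality Δ₂√s < (1−√(μs))/L; (2) (√s/2)(1+Δ₁) ≤ Δ₂ ≤ √s(1+Δ₁); (3) 1+Δ₁ ≥ 1/(1−√(μs)). Then for all k ≥ 0, f(x_k) − f(x*) ≤ (1 − Δ₂√s·L/(1−√(μs)))^{−1}·((1−√(μs))/(1+Δ₁))·(1+√(μs))^{−k}·E(0). -/
open Filter Topology in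
/-- First-order lower bound for a differentiable strongly convex function. -/
lemma StrongConvexOn.add_inner_gradient_le {H : Type*} [NormedAddCommGroup H]
    [InnerProductSpace ℝ H] [CompleteSpace H] {f : H → ℝ} {μ : ℝ}
    (hsc : StrongConvexOn Set.univ μ f) (hf : Differentiable ℝ f) (x z : H) :
    f z + inner ℝ (gradient f z) (x - z) + μ / 2 * ‖x - z‖ ^ 2 ≤ f x := by
  have hd : HasDerivAt (fun t : ℝ => f (z + t • (x - z))) (inner ℝ (gradient f z) (x - z)) 0 := by
    have := (hf z).hasGradientAt.hasFDerivAt.hasLineDerivAt (x - z)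
    simpa [HasLineDerivAt] using this
  have hslope := hd.tendsto_slope_zero_right
  simp only [zero_add, zero_smul, add_zero] at hslope
  have hlim : Tendsto (fun t : ℝ => f x - f z - (1 - t) * (μ / 2 * ‖x - z‖ ^ 2)) (𝓝[>] 0)
      (𝓝 (f x - f z - (1 - 0) * (μ / 2 * ‖x - z‖ ^ 2))) :=
    (Continuous.tendsto (by fun_prop) 0).mono_left nhdsWithin_le_nhds
  have key := le_of_tendsto_of_tendsto hslope hlim (by
    filter_upwards [Ioo_mem_nhdsGT (zero_lt_one' ℝ)] with t ⟨ht0, ht1⟩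
    have h := hsc.2 (Set.mem_univ x) (Set.mem_univ z) ht0.le (sub_nonneg.2 ht1.le)
      (add_sub_cancel t 1)
    have hp : t • x + (1 - t) • z = z + t • (x - z) := by module
    rw [hp] at h
    simp only [smul_eq_mul] at h ⊢
    rw [inv_mul_le_iff₀ ht0]
    linarith)
  linarith

/-- Descent lemma: quadratic upper bound for a function with Lipschitz gradient. -/
lemma le_add_inner_gradient_of_lipschitz {H : Type*} [NormedAddCommGroup H]
    [InnerProductSpace ℝ H] [CompleteSpace H] {f : H → ℝ} {L : ℝ}
    (hf : Differentiable ℝ f)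
    (hL : ∀ x y, ‖gradient f x - gradient f y‖ ≤ L * ‖x - y‖) (x w : H) :
    f w ≤ f x + inner ℝ (gradient f x) (w - x) + L / 2 * ‖w - x‖ ^ 2 := by
  have hd (t : ℝ) : HasDerivAt (fun t : ℝ => f (x + t • (w - x)))
      (inner ℝ (gradient f (x + t • (w - x))) (w - x)) t := by
    have hline : HasDerivAt (fun t : ℝ => x + t • (w - x)) (w - x) t := by
      simpa using ((hasDerivAt_id t).smul_const (w - x)).const_add x
    exact (hf (x + t • (w - x))).hasGradientAt.hasFDerivAt.comp_hasDerivAt t hline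
  have hB (t : ℝ) : HasDerivAt
      (fun t : ℝ => f x + t * inner ℝ (gradient f x) (w - x) + L / 2 * ‖w - x‖ ^ 2 * t ^ 2)
      (inner ℝ (gradient f x) (w - x) + L * ‖w - x‖ ^ 2 * t) t := by
    refine ((((hasDerivAt_id t).mul_const (inner ℝ (gradient f x) (w - x))).const_add (f x)).add
      ((hasDerivAt_pow 2 t).const_mul (L / 2 * ‖w - x‖ ^ 2))).congr_deriv ?_
    push_cast
    ring
  have := image_le_of_deriv_right_le_deriv_boundary (a := 0) (b := 1)
    (fun t _ => (hd t).continuousAt.continuousWithinAt) (fun t _ => (hd t).hasDerivWithinAt)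
    (by simp) (fun t _ => (hB t).continuousAt.continuousWithinAt)
    (fun t _ => (hB t).hasDerivWithinAt)
    (by
      intro t ht
      have h1 := real_inner_le_norm (gradient f (x + t • (w - x)) - gradient f x) (w - x)
      have h2 := hL (x + t • (w - x)) x
      rw [add_sub_cancel_left, norm_smul, Real.norm_of_nonneg ht.1] at h2
      rw [inner_sub_left] at h1
      nlinarith [mul_le_mul_of_nonneg_right h2 (norm_nonneg (w - x))])
    (Set.right_mem_Icc.2 zero_le_one)
  simpa using this

/-- A differentiable function lying above its tangents and having `L`-Lipschitz gradient exceeds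
its tangents by the squared variation of the gradient. -/
lemma add_inner_gradient_add_sq_le {H : Type*} [NormedAddCommGroup H]
    [InnerProductSpace ℝ H] [CompleteSpace H] {f : H → ℝ} {L : ℝ} (hLpos : 0 < L)
    (hf : Differentiable ℝ f) (hc : ∀ x z, f z + inner ℝ (gradient f z) (x - z) ≤ f x)
    (hL : ∀ x y, ‖gradient f x - gradient f y‖ ≤ L * ‖x - y‖) (x z : H) :
    f z + inner ℝ (gradient f z) (x - z) + 1 / (2 * L) * ‖gradient f x - gradient f z‖ ^ 2
      ≤ f x := by
  set d := gradient f x - gradient f z with hd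
  have h1 := hc (x - L⁻¹ • d) z
  have h2 := le_add_inner_gradient_of_lipschitz hf hL x (x - L⁻¹ • d)
  have h3 : inner ℝ (gradient f x) d - inner ℝ (gradient f z) d = ‖d‖ ^ 2 := by
    rw [← inner_sub_left, ← hd, real_inner_self_eq_norm_sq]
  have h4 : x - L⁻¹ • d - z = (x - z) - L⁻¹ • d := by abel
  have h5 : x - L⁻¹ • d - x = -(L⁻¹ • d) := by abel
  have h6 : L / 2 * (L⁻¹ * ‖d‖) ^ 2 = 1 / (2 * L) * ‖d‖ ^ 2 := by field_simp
  have h7 : L⁻¹ * ‖d‖ ^ 2 = 2 * (1 / (2 * L) * ‖d‖ ^ 2) := by field_simp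
  rw [h4, inner_sub_right, real_inner_smul_right] at h1
  rw [h5, inner_neg_right, real_inner_smul_right, norm_neg, norm_smul,
    Real.norm_of_nonneg (inv_nonneg.2 hLpos.le), h6] at h2
  have h8 := congrArg (L⁻¹ * ·) h3
  simp only [mul_sub] at h8
  linarith

/-- One-step decay of the (rescaled) Lyapunov function of the modified symplectic Euler scheme.
Here `m`, `h` stand for `√μ`, `√s`, and `v₁`, `y`, `g₁`, `f₁` (resp. `v₀`, `g₀`, `f₀`) for the new
(resp. old) velocity, displacement from the minimizer, gradient and optimality gap. -/
lemma symplectic_lyapunov_decay {H : Type*} [NormedAddCommGroup H] [InnerProductSpace ℝ H]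
    {m h a D L f₀ f₁ : ℝ} {v₀ v₁ y g₀ g₁ : H} (hm : 0 < m) (hh : 0 < h) (hr : m * h < 1)
    (ha : 0 ≤ a) (hD : 0 ≤ D)
    (hv : (1 - m * h) • v₀ = (1 + m * h) • v₁ + (a * h) • g₁ + D • (g₁ - g₀))
    (hstep : f₁ - h * inner ℝ g₁ v₀ + 1 / (2 * L) * ‖g₀ - g₁‖ ^ 2 ≤ f₀)
    (hgap : f₁ + m ^ 2 / 2 * ‖y‖ ^ 2 ≤ inner ℝ y g₁) (hf₁ : 0 ≤ f₁)
    (h1 : D * h ≤ (1 - m * h) / L) (h2 : h / 2 * a ≤ D) (h2' : D ≤ h * a)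
    (h3 : 1 ≤ (1 - m * h) * a) :
    (1 + m * h) * (a * ((1 - m * h) * f₁ - D * h / 2 * ‖g₁‖ ^ 2)
        + 1 / 2 * ‖v₁ + m • y + D • g₁‖ ^ 2)
      ≤ a * ((1 - m * h) * f₀ - D * h / 2 * ‖g₀‖ ^ 2)
        + 1 / 2 * ‖v₁ + m • y + D • g₁ + (m * h) • v₁ + (a * h) • g₁‖ ^ 2 := by
  have hq : 0 < m * h := mul_pos hm hh
  have hy : 0 ≤ inner ℝ y g₁ := le_trans (by positivity) hgap
  have hgv : (1 - m * h) * inner ℝ g₁ v₀ = (1 + m * h) * inner ℝ v₁ g₁ + a * h * ‖g₁‖ ^ 2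
      + D * (‖g₁‖ ^ 2 - inner ℝ g₁ g₀) := by
    rw [← real_inner_smul_right, hv]
    simp only [inner_add_right, inner_sub_right, real_inner_smul_right, real_inner_self_eq_norm_sq,
      real_inner_comm v₁ g₁]
  have e1 : ‖g₀ - g₁‖ ^ 2 = ‖g₀‖ ^ 2 - 2 * inner ℝ g₁ g₀ + ‖g₁‖ ^ 2 := by
    rw [norm_sub_sq_real, real_inner_comm]
  have e2 (α β γ : ℝ) : ‖α • v₁ + β • y + γ • g₁‖ ^ 2 =
      α ^ 2 * ‖v₁‖ ^ 2 + β ^ 2 * ‖y‖ ^ 2 + γ ^ 2 * ‖g₁‖ ^ 2 + 2 * α * β * inner ℝ v₁ y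
        + 2 * α * γ * inner ℝ v₁ g₁ + 2 * β * γ * inner ℝ y g₁ := by
    simp only [norm_add_sq_real, inner_add_left, real_inner_smul_left, real_inner_smul_right,
      norm_smul, mul_pow, Real.norm_eq_abs, sq_abs]
    ring
  have e3 : v₁ + m • y + D • g₁ = (1 : ℝ) • v₁ + m • y + D • g₁ := by module
  have e4 : (1 : ℝ) • v₁ + m • y + D • g₁ + (m * h) • v₁ + (a * h) • g₁
      = (1 + m * h) • v₁ + m • y + (D + a * h) • g₁ := by module
  rw [e3, e4, e2, e2]
  have p1 := mul_le_mul_of_nonneg_left hstep (mul_nonneg ha (sub_nonneg.2 hr.le))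
  have p2 := mul_le_mul_of_nonneg_left hgap
    (mul_nonneg (mul_nonneg hq.le ha) (sub_nonneg.2 hr.le))
  have p3 : 0 ≤ m * h * (m * (h * a - D)) * inner ℝ y g₁ :=
    mul_nonneg (mul_nonneg hq.le (mul_nonneg hm.le (sub_nonneg.2 h2'))) hy
  have p4 : 0 ≤ m * h * (m ^ 2 / 2) * ((1 - m * h) * a - 1) * ‖y‖ ^ 2 :=
    mul_nonneg (mul_nonneg (by positivity) (sub_nonneg.2 h3)) (by positivity)
  have p5 : 0 ≤ a * h * (D - h / 2 * a) * ‖g₁‖ ^ 2 :=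
    mul_nonneg (mul_nonneg (by positivity) (sub_nonneg.2 h2)) (by positivity)
  have p6 : 0 ≤ m * h * D / 2 * (h * a - D) * ‖g₁‖ ^ 2 :=
    mul_nonneg (mul_nonneg (by positivity) (sub_nonneg.2 h2')) (by positivity)
  have p7 : 0 ≤ (m * h / 2 + (m * h) ^ 2 / 2) * ‖v₁‖ ^ 2 := by positivity
  have p8 : 0 ≤ a / 2 * ((1 - m * h) / L - D * h) * ‖g₀ - g₁‖ ^ 2 :=
    mul_nonneg (mul_nonneg (by positivity) (sub_nonneg.2 h1)) (by positivity)
  have e5 : 1 / (2 * L) = 1 / L / 2 := by rw [mul_comm, div_div]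
  rw [e5, e1] at p1
  rw [div_eq_mul_one_div, e1] at p8
  linear_combination p1 + p2 + p3 + p4 + p5 + p6 + p7 + p8 + a * h * hgv

/-- for the modified symplectic Euler scheme under conditions (1)–(3) with the
strict inequality `Δ₂√s < (1−√(μs))/L`, the function values converge at the stated rate. -/
theorem modified_symplectic_function_value_rate
    {H : Type*} [NormedAddCommGroup H] [InnerProductSpace ℝ H] [CompleteSpace H]
    (f : H → ℝ) (μ L : ℝ) (hμ : 0 < μ)
    (hf : ContDiff ℝ 1 f) (hsc : StrongConvexOn Set.univ μ f)
    (hL : ∀ x y, ‖gradient f x - gradient f y‖ ≤ L * ‖x - y‖)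
    (xs : H) (hmin : ∀ y, f xs ≤ f y)
    (s : ℝ) (hs : 0 < s) (hμs : Real.sqrt (μ * s) < 1)
    (Δ₁ Δ₂ : ℝ) (hΔ₁ : 0 ≤ Δ₁) (hΔ₂ : 0 ≤ Δ₂)
    (x v : ℕ → H)
    (hx : ∀ k, (Real.sqrt s)⁻¹ • (x (k + 1) - x k) = v k)
    (hv : ∀ k, (Real.sqrt s)⁻¹ • (v (k + 1) - v k) =
      -(Real.sqrt μ • (v (k + 1) + v k)) - (1 + Δ₁) • gradient f (x (k + 1))
        - (Δ₂ / Real.sqrt s) • (gradient f (x (k + 1)) - gradient f (x k)))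
    (E : ℕ → ℝ)
    (hE : ∀ k, E k = (1 + Real.sqrt (μ * s)) ^ k *
      ((1 + Δ₁) / (1 - Real.sqrt (μ * s)) *
          (f (x k) - f xs
            - Δ₂ * Real.sqrt s / (2 * (1 - Real.sqrt (μ * s))) * ‖gradient f (x k)‖ ^ 2) +
        (1 / 2) * ‖v k + (Real.sqrt μ / (1 - Real.sqrt (μ * s))) • (x (k + 1) - xs)
          + (Δ₂ / (1 - Real.sqrt (μ * s))) • gradient f (x k)‖ ^ 2))
    (h1 : Δ₂ * Real.sqrt s / (1 - Real.sqrt (μ * s)) ≤ 1 / L)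
    (h1' : Δ₂ * Real.sqrt s < (1 - Real.sqrt (μ * s)) / L)
    (h2 : Real.sqrt s / 2 * (1 + Δ₁) ≤ Δ₂) (h2' : Δ₂ ≤ Real.sqrt s * (1 + Δ₁))
    (h3 : 1 / (1 - Real.sqrt (μ * s)) ≤ 1 + Δ₁) :
    ∀ k, f (x k) - f xs ≤
      (1 - Δ₂ * Real.sqrt s * L / (1 - Real.sqrt (μ * s)))⁻¹ *
        ((1 - Real.sqrt (μ * s)) / (1 + Δ₁)) * ((1 + Real.sqrt (μ * s)) ^ k)⁻¹ * E 0 := by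
  set h := Real.sqrt s with hh_def
  set m := Real.sqrt μ with hm_def
  have hq : Real.sqrt (μ * s) = m * h := Real.sqrt_mul hμ.le s
  simp only [hq] at hμs h1' h3 hE ⊢
  have hh : 0 < h := Real.sqrt_pos.2 hs
  have hm : 0 < m := Real.sqrt_pos.2 hμ
  have hm2 : m ^ 2 = μ := Real.sq_sqrt hμ.le
  have hr : 0 < 1 - m * h := sub_pos.2 hμs
  have ha : 0 < 1 + Δ₁ := by linarith
  have hLpos : 0 < L := by
    by_contra hneg
    have : (1 - m * h) / L ≤ 0 := div_nonpos_of_nonneg_of_nonpos hr.le (not_lt.1 hneg)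
    have : 0 ≤ Δ₂ * h := by positivity
    linarith
  have hdiff : Differentiable ℝ f := hf.differentiable one_ne_zero
  have hstrong := hsc.add_inner_gradient_le hdiff
  have hconv (x z : H) : f z + inner ℝ (gradient f z) (x - z) ≤ f x :=
    le_trans (le_add_of_nonneg_right (by positivity)) (hstrong x z)
  have hcoc := add_inner_gradient_add_sq_le hLpos hdiff hconv hL
  have hgrad0 : gradient f xs = 0 := by
    have : IsLocalMin f xs := Filter.Eventually.of_forall hmin
    rw [gradient, this.fderiv_eq_zero, map_zero]
  have hx' (k : ℕ) : x (k + 1) = x k + h • v k := by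
    rw [← hx k, smul_inv_smul₀ hh.ne', add_sub_cancel]
  have hv' (k : ℕ) : (1 - m * h) • v k = (1 + m * h) • v (k + 1)
      + ((1 + Δ₁) * h) • gradient f (x (k + 1))
      + Δ₂ • (gradient f (x (k + 1)) - gradient f (x k)) := by
    have e := congrArg (h • ·) (hv k)
    simp only [smul_inv_smul₀ hh.ne', smul_sub h, smul_neg, smul_smul, mul_div_cancel₀ _ hh.ne'] at e
    linear_combination (norm := module) (-1 : ℝ) • e
  have hw (k : ℕ) : v k + (m / (1 - m * h)) • (x (k + 1) - xs)
      + (Δ₂ / (1 - m * h)) • gradient f (x k)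
      = (1 - m * h)⁻¹ • (v k + m • (x k - xs) + Δ₂ • gradient f (x k)) := by
    rw [hx']
    match_scalars <;> field_simp
    ring
  have hE' (k : ℕ) : E k = (1 + m * h) ^ k * (((1 - m * h) ^ 2)⁻¹ *
      ((1 + Δ₁) * ((1 - m * h) * (f (x k) - f xs) - Δ₂ * h / 2 * ‖gradient f (x k)‖ ^ 2)
        + 1 / 2 * ‖v k + m • (x k - xs) + Δ₂ • gradient f (x k)‖ ^ 2)) := by
    rw [hE, hw, norm_smul, Real.norm_of_nonneg (inv_nonneg.2 hr.le)]
    field_simp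
  have hdecay : ∀ k, E k ≤ E 0 := by
    refine fun k => antitone_nat_of_succ_le (fun k => ?_) (Nat.zero_le k)
    rw [hE', hE', pow_succ, mul_assoc, mul_left_comm (1 + m * h)]
    gcongr
    have hu : v k + m • (x k - xs) + Δ₂ • gradient f (x k) =
        v (k + 1) + m • (x (k + 1) - xs) + Δ₂ • gradient f (x (k + 1)) + (m * h) • v (k + 1)
          + ((1 + Δ₁) * h) • gradient f (x (k + 1)) := by
      linear_combination (norm := module) hv' k - m • hx' k
    rw [hu]
    have hc := hcoc (x k) (x (k + 1))
    have hs' := hstrong xs (x (k + 1))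
    have ex : x k - x (k + 1) = -(h • v k) := by rw [hx' k]; abel
    rw [ex, inner_neg_right, real_inner_smul_right] at hc
    rw [← neg_sub (x (k + 1)) xs, inner_neg_right, norm_neg, real_inner_comm, ← hm2] at hs'
    refine symplectic_lyapunov_decay (L := L) hm hh hμs ha.le hΔ₂ (hv' k) (by linarith)
      (by linarith) (sub_nonneg.2 (hmin _)) h1'.le h2 h2' ?_
    rwa [div_le_iff₀' hr] at h3
  intro k
  have hcr : 0 < 1 - Δ₂ * h * L / (1 - m * h) := by
    rw [sub_pos, div_lt_one hr]
    rwa [lt_div_iff₀ hLpos] at h1'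
  have hg : ‖gradient f (x k)‖ ^ 2 ≤ 2 * L * (f (x k) - f xs) := by
    have := hcoc (x k) xs
    rw [hgrad0, inner_zero_left, sub_zero, add_zero] at this
    rw [← div_le_iff₀' (by positivity), div_eq_inv_mul, ← one_div]
    linarith
  have hpow : 0 < (1 + m * h) ^ k := by positivity
  have hlow : (1 + m * h) ^ k * ((1 + Δ₁) / (1 - m * h) *
      ((1 - Δ₂ * h * L / (1 - m * h)) * (f (x k) - f xs))) ≤ E 0 := by
    refine le_trans ?_ (hdecay k)
    rw [hE]
    refine mul_le_mul_of_nonneg_left (le_add_of_le_of_nonneg ?_ (by positivity)) hpow.le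
    refine mul_le_mul_of_nonneg_left ?_ (by positivity)
    have := mul_le_mul_of_nonneg_left hg
      (show 0 ≤ Δ₂ * h / (2 * (1 - m * h)) by positivity)
    have e : Δ₂ * h / (2 * (1 - m * h)) * (2 * L * (f (x k) - f xs))
        = Δ₂ * h * L / (1 - m * h) * (f (x k) - f xs) := by field_simp
    linarith
  calc f (x k) - f xs = (1 - Δ₂ * h * L / (1 - m * h))⁻¹ * ((1 - m * h) / (1 + Δ₁))
        * ((1 + m * h) ^ k)⁻¹ * ((1 + m * h) ^ k * ((1 + Δ₁) / (1 - m * h) *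
          ((1 - Δ₂ * h * L / (1 - m * h)) * (f (x k) - f xs)))) := by
        generalize 1 - Δ₂ * h * L / (1 - m * h) = c at hcr
        field_simp
    _ ≤ _ := mul_le_mul_of_nonneg_left hlow (by positivity)
end
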